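/- arXiv:2102.13009 — 8 statements merged into one kernel-verified Lean document; each statement's English description precedes it below -/
import Mathlib

section
/- There exists a universal constant c₀ > 0 such that for every probability measure μ on ℝ² with ∫∫ log(1+‖x−y‖²) dμ(x)dμ(y) < ∞, one has I(μ) ≥ c₀ · r(μ)⁴ / (1 + r(μ)²)⁴, where r(μ) is the infimum of the sidelengths of axis-parallel squares carrying μ-measure at least 1/200. -/
open MeasureTheory

/-- The t-SNE mean-field functional
`I(μ) = log(∫∫ 1/(1+‖x−y‖²) dμ dμ) + ∫∫ log(1+‖x−y‖²) dμ dμ`. -/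
noncomputable def tsneI (μ : Measure (EuclideanSpace ℝ (Fin 2))) : ℝ :=
  Real.log (∫ x, ∫ y, 1 / (1 + ‖x - y‖ ^ 2) ∂μ ∂μ) +
    ∫ x, ∫ y, Real.log (1 + ‖x - y‖ ^ 2) ∂μ ∂μ

/-- The axis-parallel square `[u, u+s] × [v, v+s]` in `ℝ²`. -/
def axisSquare (u v s : ℝ) : Set (EuclideanSpace ℝ (Fin 2)) :=
  {x | x 0 ∈ Set.Icc u (u + s) ∧ x 1 ∈ Set.Icc v (v + s)}

/-- The length scale `r(μ)`: the infimum of sidelengths of axis-parallel squares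
carrying `μ`-measure at least `1/200`. -/
noncomputable def lengthScale (μ : Measure (EuclideanSpace ℝ (Fin 2))) : ℝ :=
  sInf {s : ℝ | 0 ≤ s ∧ ∃ u v : ℝ, (1 / 200 : ENNReal) ≤ μ (axisSquare u v s)}

/-- A quantitative form of `1 - z ≤ exp (-z)` away from `z = 0`. -/
lemma sq_div_nine_le_exp_neg_sub_one_add {t z : ℝ} (ht₀ : 0 ≤ t) (ht₁ : t ≤ 1) (h : t ≤ |z|) :
    t ^ 2 / 9 ≤ Real.exp (-z) - 1 + z := by
  have hsq : Real.exp (-z) = Real.exp (-z / 2) ^ 2 := by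
    rw [← Real.exp_nat_mul]; congr 1; push_cast; ring
  have hlin := Real.add_one_le_exp (-z / 2)
  suffices t ^ 2 / 9 ≤ (Real.exp (-z / 2) - 1) ^ 2 by rw [hsq]; nlinarith
  rcases le_abs'.mp h with hz | hz
  · nlinarith
  · have hinv : Real.exp (-z / 2) * Real.exp (z / 2) = 1 := by
      rw [← Real.exp_add]; ring_nf; exact Real.exp_zero
    have hpos := Real.exp_pos (-z / 2)
    have hone := Real.add_one_le_exp (z / 2)
    have hle : Real.exp (-z / 2) * (1 + t / 2) ≤ 1 := by nlinarith
    have : Real.exp (-z / 2) ≤ 1 - t / 3 := by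
      by_contra! hlt
      nlinarith [mul_nonneg ht₀ (sub_nonneg.2 ht₁)]
    nlinarith

/-- Quantitative Jensen inequality: a nonnegative random variable `W` that is at most `a` with
probability `p` and at least `b` with probability `p` has a Jensen deficit for `exp (-W)`. -/
lemma le_log_integral_exp_neg_add_integral {Ω : Type*} [MeasurableSpace Ω] {P : Measure Ω}
    [IsProbabilityMeasure P] {W : Ω → ℝ} (hW : Integrable W P) (hW₀ : ∀ ω, 0 ≤ W ω)
    {a b t p : ℝ} (ht₀ : 0 ≤ t) (ht₁ : t ≤ 1) (hab : a + 2 * t ≤ b) (hp : 0 ≤ p)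
    {A B : Set Ω} (hA : MeasurableSet A) (hB : MeasurableSet B)
    (hAW : ∀ ω ∈ A, W ω ≤ a) (hBW : ∀ ω ∈ B, b ≤ W ω) (hpA : p ≤ P.real A)
    (hpB : p ≤ P.real B) :
    p * t ^ 2 / 18 ≤ Real.log (∫ ω, Real.exp (-W ω) ∂P) + ∫ ω, W ω ∂P := by
  set m := ∫ ω, W ω ∂P with hm
  have hexp : Integrable (fun ω => Real.exp (-W ω)) P := by
    refine (integrable_const (1 : ℝ)).mono' (Real.continuous_exp.comp_aestronglyMeasurable hW.1.neg)
      (.of_forall fun ω => ?_)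
    rw [Real.norm_eq_abs, Real.abs_exp, Real.exp_le_one_iff]
    linarith [hW₀ ω]
  have hshift : ∀ ω, Real.exp (-(W ω - m)) = Real.exp m * Real.exp (-W ω) := fun ω => by
    rw [← Real.exp_add]; ring_nf
  set φ : Ω → ℝ := fun ω => Real.exp (-(W ω - m)) - 1 + (W ω - m) with hφ
  have hφint : Integrable φ P := by
    simp only [hφ, hshift]
    exact ((hexp.const_mul _).sub (integrable_const _)).add (hW.sub (integrable_const _))
  have hφ₀ : ∀ ω, 0 ≤ φ ω := fun ω => by
    have := Real.add_one_le_exp (-(W ω - m))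
    simp only [hφ]; linarith
  have hφeq : ∫ ω, φ ω ∂P = Real.exp m * ∫ ω, Real.exp (-W ω) ∂P - 1 := by
    simp only [hφ, hshift]
    have h₁ : Integrable (fun ω => Real.exp m * Real.exp (-W ω) - 1) P :=
      (hexp.const_mul _).sub (integrable_const _)
    have h₂ : Integrable (fun ω => W ω - m) P := hW.sub (integrable_const _)
    rw [integral_add h₁ h₂, integral_sub (hexp.const_mul _) (integrable_const _),
      integral_sub hW (integrable_const _), integral_const_mul]
    simp [← hm]
  have hset : ∀ S : Set Ω, MeasurableSet S → p ≤ P.real S → (∀ ω ∈ S, t ≤ |W ω - m|) →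
      p * (t ^ 2 / 9) ≤ ∫ ω, φ ω ∂P := by
    intro S hS hpS hSW
    calc p * (t ^ 2 / 9) ≤ P.real S * (t ^ 2 / 9) := by gcongr
      _ = ∫ _ in S, t ^ 2 / 9 ∂P := by simp
      _ ≤ ∫ ω in S, φ ω ∂P := setIntegral_mono_on integrableOn_const hφint.integrableOn hS
          fun ω hω => sq_div_nine_le_exp_neg_sub_one_add ht₀ ht₁ (hSW ω hω)
      _ ≤ ∫ ω, φ ω ∂P := setIntegral_le_integral hφint (.of_forall hφ₀)
  have hδ : p * (t ^ 2 / 9) ≤ ∫ ω, φ ω ∂P := by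
    rcases le_total (a + t) m with h | h
    · refine hset A hA hpA fun ω hω => ?_
      rw [le_abs']; left; linarith [hAW ω hω]
    · refine hset B hB hpB fun ω hω => ?_
      rw [le_abs']; right; linarith [hBW ω hω]
  have hp₁ : p ≤ 1 := hpA.trans measureReal_le_one
  set κ := p * (t ^ 2 / 9) with hκ
  have hκ₀ : 0 ≤ κ := by positivity
  have hκ₁ : κ ≤ 1 := mul_le_one₀ hp₁ (by positivity) (by nlinarith)
  have hpos : 0 < ∫ ω, Real.exp (-W ω) ∂P := integral_exp_pos hexp
  calc p * t ^ 2 / 18 = κ / 2 := by rw [hκ]; ring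
    _ ≤ 1 - (1 + κ)⁻¹ := by
        rw [le_sub_iff_add_le, ← le_sub_iff_add_le', inv_le_iff_one_le_mul₀ (by positivity)]
        nlinarith
    _ ≤ Real.log (1 + κ) := Real.one_sub_inv_le_log_of_pos (by positivity)
    _ ≤ Real.log (Real.exp m * ∫ ω, Real.exp (-W ω) ∂P) :=
        Real.log_le_log (by positivity) (by linarith)
    _ = Real.log (∫ ω, Real.exp (-W ω) ∂P) + m := by
        rw [Real.log_mul (Real.exp_ne_zero _) hpos.ne', Real.log_exp, add_comm]

lemma measurableSet_axisSquare (u v s : ℝ) : MeasurableSet (axisSquare u v s) := by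
  have h (i : Fin 2) : Measurable fun x : EuclideanSpace ℝ (Fin 2) => x i := by fun_prop
  exact (h 0 measurableSet_Icc).inter (h 1 measurableSet_Icc)

lemma norm_sub_sq_eq_fin_two (x y : EuclideanSpace ℝ (Fin 2)) :
    ‖x - y‖ ^ 2 = (x 0 - y 0) ^ 2 + (x 1 - y 1) ^ 2 := by
  simp [EuclideanSpace.norm_sq_eq, Fin.sum_univ_two]

/-- A square of sidelength `5 * s` is covered by 36 squares of sidelength `s`. -/
lemma axisSquare_five_mul_subset {s : ℝ} (hs : 0 < s) (u v : ℝ) :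
    axisSquare u v (5 * s) ⊆ ⋃ ij ∈ Finset.range 6 ×ˢ Finset.range 6,
      axisSquare (u + ij.1 * s) (v + ij.2 * s) s := by
  have key : ∀ w z : ℝ, z ∈ Set.Icc w (w + 5 * s) →
      ∃ i < 6, z ∈ Set.Icc (w + (i : ℕ) * s) (w + i * s + s) := by
    intro w z hz
    have hnn : 0 ≤ (z - w) / s := div_nonneg (by linarith [hz.1]) hs.le
    refine ⟨⌊(z - w) / s⌋₊, ?_, ?_, ?_⟩
    · rw [Nat.floor_lt hnn, div_lt_iff₀ hs]
      push_cast
      linarith [hz.2]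
    · have := Nat.floor_le hnn
      rw [le_div_iff₀ hs] at this
      linarith
    · have := Nat.lt_floor_add_one ((z - w) / s)
      rw [div_lt_iff₀ hs] at this
      linarith
  rintro x ⟨h0, h1⟩
  obtain ⟨i, hi, hxi⟩ := key u _ h0
  obtain ⟨j, hj, hxj⟩ := key v _ h1
  simp only [Set.mem_iUnion]
  exact ⟨(i, j), by simp [hi, hj], hxi, hxj⟩

section LengthScale

variable (μ : Measure (EuclideanSpace ℝ (Fin 2)))

lemma lengthScale_nonneg : 0 ≤ lengthScale μ := Real.sInf_nonneg fun _ h => h.1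

lemma measure_axisSquare_lt_of_lt_lengthScale {s : ℝ} (hs₀ : 0 ≤ s) (hs : s < lengthScale μ)
    (u v : ℝ) : μ (axisSquare u v s) < 1 / 200 := by
  by_contra! h
  exact hs.not_ge (csInf_le ⟨0, fun _ h => h.1⟩ ⟨hs₀, u, v, h⟩)

lemma exists_axisSquare_of_lengthScale_lt {s : ℝ} (hr : 0 < lengthScale μ)
    (hs : lengthScale μ < s) :
    ∃ u v s', 0 ≤ s' ∧ s' < s ∧ (1 / 200 : ENNReal) ≤ μ (axisSquare u v s') := by
  have hne : {s : ℝ | 0 ≤ s ∧ ∃ u v : ℝ, (1 / 200 : ENNReal) ≤ μ (axisSquare u v s)}.Nonempty := by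
    by_contra! h
    rw [lengthScale, h, Real.sInf_empty] at hr
    exact hr.false
  obtain ⟨s', ⟨h₀, u, v, h⟩, hs'⟩ := exists_lt_of_csInf_lt hne hs
  exact ⟨u, v, s', h₀, hs', h⟩

lemma measure_axisSquare_four_mul_lengthScale_le (hr : 0 < lengthScale μ) (u v : ℝ) :
    μ (axisSquare u v (4 * lengthScale μ)) ≤ 36 / 200 := by
  have h45 : 4 * lengthScale μ = 5 * (4 / 5 * lengthScale μ) := by ring
  rw [h45]
  refine (measure_mono (axisSquare_five_mul_subset (by positivity) u v)).trans <|
    (measure_biUnion_finset_le _ _).trans <|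
    (Finset.sum_le_card_nsmul _ _ (1 / 200) fun ij _ =>
      (measure_axisSquare_lt_of_lt_lengthScale μ (by positivity) (by linarith) _ _).le).trans ?_
  simp [div_eq_mul_inv]

/-- Two independent points are far apart with probability bounded below. -/
lemma le_prod_real_two_mul_lengthScale_lt [IsProbabilityMeasure μ] (hr : 0 < lengthScale μ) :
    1 / 2 ≤ (μ.prod μ).real {q | 4 * lengthScale μ ^ 2 ≤ ‖q.1 - q.2‖ ^ 2} := by
  set F : Set (EuclideanSpace ℝ (Fin 2) × EuclideanSpace ℝ (Fin 2)) :=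
    {q | 4 * lengthScale μ ^ 2 ≤ ‖q.1 - q.2‖ ^ 2} with hF
  have hFm : MeasurableSet F := measurableSet_le (by fun_prop) (by fun_prop)
  have hle : (μ.prod μ) Fᶜ ≤ 36 / 200 := by
    rw [Measure.prod_apply hFm.compl]
    calc ∫⁻ x, μ (Prod.mk x ⁻¹' Fᶜ) ∂μ ≤ ∫⁻ _, 36 / 200 ∂μ := by
          refine lintegral_mono fun x => (measure_mono ?_).trans
            (measure_axisSquare_four_mul_lengthScale_le μ hr
              (x 0 - 2 * lengthScale μ) (x 1 - 2 * lengthScale μ))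
          intro y hy
          simp only [hF, Set.mem_preimage, Set.mem_compl_iff, Set.mem_ofPred_eq, not_le,
            norm_sub_sq_eq_fin_two] at hy
          have h0 : |x 0 - y 0| < 2 * lengthScale μ :=
            abs_lt_of_sq_lt_sq (by nlinarith [sq_nonneg (x 1 - y 1)]) (by positivity)
          have h1 : |x 1 - y 1| < 2 * lengthScale μ :=
            abs_lt_of_sq_lt_sq (by nlinarith [sq_nonneg (x 0 - y 0)]) (by positivity)
          rw [abs_lt] at h0 h1
          exact ⟨⟨by linarith, by linarith⟩, by linarith, by linarith⟩
      _ = 36 / 200 := by simp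
  have hreal : (μ.prod μ).real Fᶜ ≤ 36 / 200 := by
    have := ENNReal.toReal_mono (ENNReal.div_ne_top (by simp) (by simp)) hle
    simpa [Measure.real, ENNReal.toReal_div] using this
  rw [probReal_compl_eq_one_sub hFm] at hreal
  linarith

end LengthScale

/-- There is a universal constant `c₀ > 0` such that for every Borel
probability measure `μ` on `ℝ²` with `∫∫ log(1+‖x−y‖²) dμ dμ < ∞`,
`I(μ) ≥ c₀ · r(μ)⁴ / (1 + r(μ)²)⁴`. -/
theorem tsneI_lower_bound_lengthScale :
    ∃ c₀ : ℝ, 0 < c₀ ∧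
      ∀ (μ : Measure (EuclideanSpace ℝ (Fin 2))), IsProbabilityMeasure μ →
        Integrable
          (fun p : EuclideanSpace ℝ (Fin 2) × EuclideanSpace ℝ (Fin 2) =>
            Real.log (1 + ‖p.1 - p.2‖ ^ 2)) (μ.prod μ) →
        c₀ * (lengthScale μ) ^ 4 / (1 + (lengthScale μ) ^ 2) ^ 4 ≤ tsneI μ := by
  refine ⟨1 / 46080000, by norm_num, fun μ _ hint => ?_⟩
  set r := lengthScale μ with hr
  have hr₀ : 0 ≤ r := lengthScale_nonneg μ
  have hexp : ∀ x y : EuclideanSpace ℝ (Fin 2),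
      1 / (1 + ‖x - y‖ ^ 2) = Real.exp (-Real.log (1 + ‖x - y‖ ^ 2)) := fun x y => by
    rw [Real.exp_neg, Real.exp_log (by positivity), one_div]
  have hW₀ : ∀ q : EuclideanSpace ℝ (Fin 2) × EuclideanSpace ℝ (Fin 2),
      0 ≤ Real.log (1 + ‖q.1 - q.2‖ ^ 2) := fun q =>
    Real.log_nonneg (by nlinarith [norm_nonneg (q.1 - q.2)])
  have hexpint : Integrable (fun q : EuclideanSpace ℝ (Fin 2) × EuclideanSpace ℝ (Fin 2) =>
      Real.exp (-Real.log (1 + ‖q.1 - q.2‖ ^ 2))) (μ.prod μ) := by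
    refine (integrable_const (1 : ℝ)).mono' (Real.continuous_exp.comp_aestronglyMeasurable hint.1.neg)
      (.of_forall fun q => ?_)
    rw [Real.norm_eq_abs, Real.abs_exp, Real.exp_le_one_iff]
    linarith [hW₀ q]
  have hI : tsneI μ = Real.log (∫ q, Real.exp (-Real.log (1 + ‖q.1 - q.2‖ ^ 2)) ∂μ.prod μ) +
      ∫ q, Real.log (1 + ‖q.1 - q.2‖ ^ 2) ∂μ.prod μ := by
    simp only [tsneI, hexp]
    rw [integral_prod _ hexpint, integral_prod _ hint]
  rw [hI]
  rcases hr₀.eq_or_lt with h0 | hpos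
  · simpa [← h0] using le_log_integral_exp_neg_add_integral hint hW₀ (a := 0) (b := 0) le_rfl
      zero_le_one (by simp) le_rfl .empty .empty (by simp) (by simp) (by simp) (by simp)
  obtain ⟨u, v, s, hs₀, hs, hQ⟩ := exists_axisSquare_of_lengthScale_lt μ hpos
    (show r < 6 / 5 * r by linarith)
  have hQreal : 1 / 200 ≤ μ.real (axisSquare u v s) := by
    have := ENNReal.toReal_mono (measure_ne_top _ _) hQ
    simpa [Measure.real] using this
  have ht₁ : r ^ 2 / (8 * (1 + r ^ 2)) ≤ 1 := by
    rw [div_le_one (by positivity)]; nlinarith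
  have hgap : Real.log (1 + 3 * r ^ 2) + 2 * (r ^ 2 / (8 * (1 + r ^ 2))) ≤
      Real.log (1 + 4 * r ^ 2) := by
    have hlog := Real.one_sub_inv_le_log_of_pos
      (show 0 < (1 + 4 * r ^ 2) / (1 + 3 * r ^ 2) by positivity)
    rw [Real.log_div (by positivity) (by positivity)] at hlog
    have : 2 * (r ^ 2 / (8 * (1 + r ^ 2))) ≤ 1 - ((1 + 4 * r ^ 2) / (1 + 3 * r ^ 2))⁻¹ := by
      have : 1 - ((1 + 4 * r ^ 2) / (1 + 3 * r ^ 2))⁻¹ = r ^ 2 / (1 + 4 * r ^ 2) := by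
        field_simp; ring
      rw [this, mul_div_assoc', div_le_div_iff₀ (by positivity) (by positivity)]
      nlinarith [pow_nonneg hr₀ 4, pow_nonneg hr₀ 2]
    linarith
  have hmain := le_log_integral_exp_neg_add_integral hint hW₀ (t := r ^ 2 / (8 * (1 + r ^ 2)))
    (p := 1 / 40000) (by positivity) ht₁ hgap (by norm_num)
    ((measurableSet_axisSquare u v s).prod (measurableSet_axisSquare u v s))
    (B := {q | 4 * r ^ 2 ≤ ‖q.1 - q.2‖ ^ 2})
    (measurableSet_le (by fun_prop) (by fun_prop)) ?_ ?_ ?_ ?_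
  · refine le_trans ?_ hmain
    calc 1 / 46080000 * r ^ 4 / (1 + r ^ 2) ^ 4 ≤ 1 / 46080000 * r ^ 4 / (1 + r ^ 2) ^ 2 := by
          gcongr
          · nlinarith
          · norm_num
      _ = 1 / 40000 * (r ^ 2 / (8 * (1 + r ^ 2))) ^ 2 / 18 := by
          field_simp; norm_num
  · rintro ⟨x, y⟩ ⟨⟨hx0, hx1⟩, hy0, hy1⟩
    refine Real.log_le_log (by positivity) ?_
    have h0 : |x 0 - y 0| ≤ s := abs_sub_le_iff.2 ⟨by linarith [hx0.2, hy0.1],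
      by linarith [hy0.2, hx0.1]⟩
    have h1 : |x 1 - y 1| ≤ s := abs_sub_le_iff.2 ⟨by linarith [hx1.2, hy1.1],
      by linarith [hy1.2, hx1.1]⟩
    have := sq_le_sq.2 (h0.trans (le_abs_self s))
    have := sq_le_sq.2 (h1.trans (le_abs_self s))
    simp only [norm_sub_sq_eq_fin_two]
    nlinarith
  · intro q hq
    exact Real.log_le_log (by positivity) (by simpa using hq)
  · rw [measureReal_prod_prod]
    nlinarith
  · exact le_trans (by norm_num) (le_prod_real_two_mul_lengthScale_lt μ hpos)
end

section
/- Let f(r) = log(1/2 + 1/(2(1+r²))) + (1/2)·log(1+r²), the value of I on the measure placing mass 1/2 at each of two points at distance r in ℝ². Then lim_{r→0⁺} f(r)/r⁴ = 1/8; in particular the lower bound I(μ) ≳ r(μ)⁴ for concentrated measures has the sharp fourth-power scaling. -/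
open MeasureTheory Filter

theorem tsneI_two_point_eq_half_log (r : ℝ) :
    Real.log (1 / 2 + 1 / (2 * (1 + r ^ 2))) + (1 / 2) * Real.log (1 + r ^ 2) =
      (1 / 2) * Real.log ((2 + r ^ 2) ^ 2 / (4 * (1 + r ^ 2))) := by
  have h1 : (0 : ℝ) < 1 + r ^ 2 := by positivity
  have h2 : (0 : ℝ) < 1 / 2 + 1 / (2 * (1 + r ^ 2)) := by positivity
  have h : (2 + r ^ 2) ^ 2 / (4 * (1 + r ^ 2)) =
      (1 / 2 + 1 / (2 * (1 + r ^ 2))) ^ 2 * (1 + r ^ 2) := by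
    field_simp
    ring
  rw [h, Real.log_mul (by positivity) h1.ne', Real.log_pow]
  push_cast
  ring

/-- With `f(r) = log(1/2 + 1/(2(1+r²))) + (1/2)·log(1+r²)` (the value of
the t-SNE functional `I` on the measure placing mass `1/2` at each of two points of `ℝ²`
at distance `r`), one has `lim_{r→0⁺} f(r)/r⁴ = 1/8`. -/
theorem tsneI_two_point_asymptotics :
    Tendsto
      (fun r : ℝ =>
        (Real.log (1 / 2 + 1 / (2 * (1 + r ^ 2))) + (1 / 2) * Real.log (1 + r ^ 2)) / r ^ 4)
      (nhdsWithin 0 (Set.Ioi 0)) (nhds (1 / 8)) := by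
  have lower : Tendsto (fun r : ℝ => 1 / (2 * (2 + r ^ 2) ^ 2))
      (nhdsWithin 0 (Set.Ioi 0)) (nhds (1 / 8)) := by
    have hc : Continuous fun r : ℝ => 1 / (2 * (2 + r ^ 2) ^ 2) :=
      continuous_const.div (by fun_prop) fun r => by positivity
    refine (hc.tendsto' 0 _ ?_).mono_left nhdsWithin_le_nhds
    norm_num
  have upper : Tendsto (fun r : ℝ => 1 / (8 * (1 + r ^ 2)))
      (nhdsWithin 0 (Set.Ioi 0)) (nhds (1 / 8)) := by
    have hc : Continuous fun r : ℝ => 1 / (8 * (1 + r ^ 2)) :=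
      continuous_const.div (by fun_prop) fun r => by positivity
    refine (hc.tendsto' 0 _ ?_).mono_left nhdsWithin_le_nhds
    norm_num
  refine tendsto_of_tendsto_of_tendsto_of_le_of_le' lower upper ?_ ?_ <;>
    filter_upwards [self_mem_nhdsWithin] with r (hr : 0 < r) <;>
    rw [tsneI_two_point_eq_half_log]
  · rw [le_div_iff₀ (by positivity)]
    have h := Real.one_sub_inv_le_log_of_pos
      (x := (2 + r ^ 2) ^ 2 / (4 * (1 + r ^ 2))) (by positivity)
    have e : 1 / (2 * (2 + r ^ 2) ^ 2) * r ^ 4 =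
        1 / 2 * (1 - ((2 + r ^ 2) ^ 2 / (4 * (1 + r ^ 2)))⁻¹) := by
      field_simp
      ring
    linarith
  · rw [div_le_iff₀ (by positivity)]
    have h := Real.log_le_sub_one_of_pos
      (x := (2 + r ^ 2) ^ 2 / (4 * (1 + r ^ 2))) (by positivity)
    have e : 1 / (8 * (1 + r ^ 2)) * r ^ 4 =
        1 / 2 * ((2 + r ^ 2) ^ 2 / (4 * (1 + r ^ 2)) - 1) := by
      field_simp
      ring
    linarith
end

section
/- Let n ≥ 4 and 1 ≤ k ≤ n−1 be such that the set 𝒢_{n,k} of simple k-regular graphs on the vertex set {1,…,n} is nonempty, and let G be chosen uniformly at random from 𝒢_{n,k}; for vertices i ≠ j set p_{ij} = 1 if {i,j} is an edge of G and p_{ij} = 0 otherwise. Then for any four pairwise distinct vertices i, j, k₀, ℓ: E[p_{ij}·p_{k₀ℓ}] = (k/(n−1)) · (nk/2 − 2k + 1) / C(n−2, 2), where C(n−2,2) = (n−2)(n−3)/2. -/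
open Finset
open scoped Classical

/-- The finite set of simple `k`-regular graphs on the vertex set `Fin n`. -/
noncomputable def regularGraphs (n k : ℕ) : Finset (SimpleGraph (Fin n)) :=
  Finset.univ.filter fun G => ∀ v : Fin n, G.degree v = k

/-- The edge indicator of the pair `a, b` in the graph `G`. -/
noncomputable def edgeIndicator {V : Type*} (G : SimpleGraph V) (a b : V) : ℝ :=
  if G.Adj a b then 1 else 0

lemma edgeIndicator_self {V : Type*} (G : SimpleGraph V) (a : V) : edgeIndicator G a a = 0 := by
  simp [edgeIndicator]

lemma edgeIndicator_comm {V : Type*} (G : SimpleGraph V) (a b : V) :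
    edgeIndicator G a b = edgeIndicator G b a := by
  simp [edgeIndicator, G.adj_comm]

lemma edgeIndicator_mul_self {V : Type*} (G : SimpleGraph V) (a b : V) :
    edgeIndicator G a b * edgeIndicator G a b = edgeIndicator G a b := by
  simp [edgeIndicator]

lemma sum_edgeIndicator_eq_degree {V : Type*} [Fintype V] (G : SimpleGraph V) (a : V) :
    ∑ b, edgeIndicator G a b = G.degree a := by
  simp [edgeIndicator, ← SimpleGraph.card_neighborFinset_eq_degree,
    SimpleGraph.neighborFinset_eq_filter]

lemma sum_edgeIndicator_of_mem_regularGraphs {n k : ℕ} {G : SimpleGraph (Fin n)}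
    (hG : G ∈ regularGraphs n k) (a : Fin n) : ∑ b, edgeIndicator G a b = k := by
  have h := (Finset.mem_filter.mp hG).2 a
  rw [sum_edgeIndicator_eq_degree, ← h]

lemma comap_mem_regularGraphs {n k : ℕ} {G : SimpleGraph (Fin n)}
    (hG : G ∈ regularGraphs n k) (σ : Equiv.Perm (Fin n)) :
    G.comap σ ∈ regularGraphs n k := by
  refine Finset.mem_filter.mpr ⟨Finset.mem_univ _, fun v => ?_⟩
  rw [← (Finset.mem_filter.mp hG).2 (σ v)]
  exact ((SimpleGraph.Iso.comap σ G).degree_eq v).symm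

/-- Relabelling the vertices permutes the set of regular graphs. -/
lemma sum_regularGraphs_comap {n k : ℕ} (σ : Equiv.Perm (Fin n))
    (f : SimpleGraph (Fin n) → ℝ) :
    ∑ G ∈ regularGraphs n k, f (G.comap σ) = ∑ G ∈ regularGraphs n k, f G := by
  refine Finset.sum_bij' (fun G _ => G.comap σ) (fun G _ => G.comap σ.symm)
    (fun G hG => comap_mem_regularGraphs hG σ) (fun G hG => comap_mem_regularGraphs hG σ.symm)
    (fun G _ => ?_) (fun G _ => ?_) (fun G _ => rfl)
  · ext a b; simp
  · ext a b; simp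

/-- The number of `k`-regular graphs containing both edges `ab` and `cd`. -/
noncomputable def pairCount (n k : ℕ) (a b c d : Fin n) : ℝ :=
  ∑ G ∈ regularGraphs n k, edgeIndicator G a b * edgeIndicator G c d

lemma pairCount_perm {n : ℕ} (k : ℕ) (σ : Equiv.Perm (Fin n)) (a b c d : Fin n) :
    pairCount n k (σ a) (σ b) (σ c) (σ d) = pairCount n k a b c d :=
  sum_regularGraphs_comap σ fun G => edgeIndicator G a b * edgeIndicator G c d

lemma sum_pairCount {n : ℕ} (k : ℕ) (a b c : Fin n) :
    ∑ d, pairCount n k a b c d = k * pairCount n k a b a b := by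
  simp only [pairCount]
  rw [Finset.sum_comm, Finset.mul_sum]
  refine Finset.sum_congr rfl fun G hG => ?_
  rw [← Finset.mul_sum, sum_edgeIndicator_of_mem_regularGraphs hG, edgeIndicator_mul_self, mul_comm]

lemma pairCount_self {n : ℕ} (k : ℕ) (a b c : Fin n) : pairCount n k a b c c = 0 := by
  simp [pairCount, edgeIndicator_self]

lemma pairCount_comm_left {n : ℕ} (k : ℕ) (a b c d : Fin n) :
    pairCount n k a b c d = pairCount n k b a c d := by
  simp only [pairCount, edgeIndicator_comm _ a b]

lemma pairCount_comm_right {n : ℕ} (k : ℕ) (a b c d : Fin n) :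
    pairCount n k a b c d = pairCount n k a b d c := by
  simp only [pairCount, edgeIndicator_comm _ c d]

/-- A function constant off a finite set `s` has the evident sum. -/
lemma Finset.sum_univ_eq_sum_add_mul {α : Type*} [Fintype α] (s : Finset α) (f : α → ℝ) (c : ℝ)
    (h : ∀ x ∉ s, f x = c) :
    ∑ x, f x = ∑ x ∈ s, f x + ((Fintype.card α : ℝ) - s.card) * c := by
  rw [← Finset.sum_add_sum_compl s f,
    Finset.sum_congr rfl fun x hx => h x (Finset.mem_compl.mp hx), Finset.sum_const,
    Finset.card_compl, nsmul_eq_mul, Nat.cast_sub (Finset.card_le_univ s)]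

lemma sub_one_mul_pairCount_same {n : ℕ} (k : ℕ) {a b : Fin n} (hab : a ≠ b) :
    ((n : ℝ) - 1) * pairCount n k a b a b = k * (regularGraphs n k).card := by
  have hsum : ∑ d, pairCount n k a d a d = k * (regularGraphs n k).card := by
    simp only [pairCount, edgeIndicator_mul_self]
    rw [Finset.sum_comm,
      Finset.sum_congr rfl fun G hG => sum_edgeIndicator_of_mem_regularGraphs hG a]
    simp [mul_comm]
  rw [Finset.sum_univ_eq_sum_add_mul {a} _ (pairCount n k a b a b), Finset.sum_singleton,
    pairCount_self] at hsum
  · simpa using hsum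
  · intro d hd
    have hda : d ≠ a := by simpa using hd
    have := pairCount_perm k (Equiv.swap b d) a b a b
    rwa [Equiv.swap_apply_left, Equiv.swap_apply_of_ne_of_ne hab hda.symm] at this

lemma sub_two_mul_pairCount_adjacent {n : ℕ} (k : ℕ) {a b c : Fin n} (hab : a ≠ b)
    (hac : a ≠ c) (hbc : b ≠ c) :
    ((n : ℝ) - 2) * pairCount n k a b a c = (k - 1) * pairCount n k a b a b := by
  have hsum := sum_pairCount k a b a
  rw [Finset.sum_univ_eq_sum_add_mul {a, b} _ (pairCount n k a b a c), Finset.sum_pair hab,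
    pairCount_self, Finset.card_pair hab, Fintype.card_fin] at hsum
  · push_cast at hsum
    linarith
  · intro d hd
    obtain ⟨hda, hdb⟩ : d ≠ a ∧ d ≠ b := by simpa using hd
    have := pairCount_perm k (Equiv.swap c d) a b a c
    rwa [Equiv.swap_apply_left, Equiv.swap_apply_of_ne_of_ne hac hda.symm,
      Equiv.swap_apply_of_ne_of_ne hbc hdb.symm] at this

lemma sub_three_mul_pairCount_disjoint {n : ℕ} (k : ℕ) {a b c d : Fin n} (hab : a ≠ b)
    (hac : a ≠ c) (had : a ≠ d) (hbc : b ≠ c) (hbd : b ≠ d) (hcd : c ≠ d) :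
    pairCount n k a b a c + pairCount n k b a b c + ((n : ℝ) - 3) * pairCount n k a b c d =
      k * pairCount n k a b a b := by
  have hsum := sum_pairCount k a b c
  rw [Finset.sum_univ_eq_sum_add_mul {a, b, c} _ (pairCount n k a b c d),
    Finset.sum_insert (by simp [hab, hac]), Finset.sum_pair hbc, pairCount_self,
    Finset.card_eq_three.mpr ⟨a, b, c, hab, hac, hbc, rfl⟩, Fintype.card_fin,
    pairCount_comm_right k a b c a, pairCount_comm_right k a b c b,
    pairCount_comm_left k a b b c] at hsum
  · push_cast at hsum
    linarith
  · intro e he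
    obtain ⟨hea, heb, hec⟩ : e ≠ a ∧ e ≠ b ∧ e ≠ c := by simpa using he
    have := pairCount_perm k (Equiv.swap d e) a b c d
    rwa [Equiv.swap_apply_left, Equiv.swap_apply_of_ne_of_ne had hea.symm,
      Equiv.swap_apply_of_ne_of_ne hbd heb.symm,
      Equiv.swap_apply_of_ne_of_ne hcd hec.symm] at this

/-- For `G` uniform on the (nonempty) set of simple `k`-regular graphs
on `n ≥ 4` vertices and pairwise distinct vertices `i, j, k₀, ℓ`, the edge indicators
satisfy `E[p_{ij}·p_{k₀ℓ}] = (k/(n−1)) · (nk/2 − 2k + 1) / ((n−2)(n−3)/2)`. -/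
theorem regular_graph_disjoint_pair_probability
    (n k : ℕ) (hn : 4 ≤ n) (hk1 : 1 ≤ k) (hk2 : k ≤ n - 1)
    (hne : (regularGraphs n k).Nonempty)
    (i j k₀ l : Fin n) (hij : i ≠ j) (hik : i ≠ k₀) (hil : i ≠ l)
    (hjk : j ≠ k₀) (hjl : j ≠ l) (hkl : k₀ ≠ l) :
    (∑ G ∈ regularGraphs n k,
        ((if G.Adj i j then (1 : ℝ) else 0) * (if G.Adj k₀ l then (1 : ℝ) else 0))) /
        (regularGraphs n k).card =
      ((k : ℝ) / ((n : ℝ) - 1)) *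
        (((n : ℝ) * (k : ℝ) / 2 - 2 * (k : ℝ) + 1) / (((n : ℝ) - 2) * ((n : ℝ) - 3) / 2)) := by
  have hN : ((regularGraphs n k).card : ℝ) ≠ 0 := by
    exact_mod_cast hne.card_pos.ne'
  have hn' : (4 : ℝ) ≤ n := by exact_mod_cast hn
  have h1 : (n : ℝ) - 1 ≠ 0 := by linarith
  have h2 : (n : ℝ) - 2 ≠ 0 := by linarith
  have h3 : (n : ℝ) - 3 ≠ 0 := by linarith
  have hE := sub_one_mul_pairCount_same k hij
  have hM := sub_two_mul_pairCount_adjacent k hij hik hjk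
  have hM' := sub_two_mul_pairCount_adjacent k hij.symm hjk hik
  have hS := sub_three_mul_pairCount_disjoint k hij hik hil hjk hjl hkl
  rw [pairCount_comm_left k j i j i, pairCount_comm_right k i j j i] at hM'
  change pairCount n k i j k₀ l / _ = _
  have key : ((n : ℝ) - 1) * (n - 2) * (n - 3) * pairCount n k i j k₀ l =
      k * (n * k - 4 * k + 2) * (regularGraphs n k).card := by
    linear_combination ((n : ℝ) - 1) * (n - 2) * hS - ((n : ℝ) - 1) * hM - ((n : ℝ) - 1) * hM' +
      ((n : ℝ) * k - 4 * k + 2) * hE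
  field_simp
  linear_combination key
end

section
/- Let S be a finite index set, let q ∈ [0,1] and ε ≥ 0, and let (p_e)_{e∈S} be {0,1}-valued random variables on a common probability space with E[p_e] = q for every e and |E[p_e p_{e'}] − q²| ≤ ε for all e ≠ e'. Then for all real numbers (x_e)_{e∈S}: Var(Σ_{e∈S} p_e x_e) ≥ q(1−q)·Σ_{e∈S} x_e² − ε·(Σ_{e∈S} |x_e|)². -/
open MeasureTheory ProbabilityTheory

/-- Let `(p_e)_{e∈S}` be `{0,1}`-valued random variables with
`E[p_e] = q` for all `e` and `|E[p_e p_{e'}] − q²| ≤ ε` for all `e ≠ e'`. Then for all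
reals `(x_e)`, `Var(Σ_e p_e x_e) ≥ q(1−q)·Σ_e x_e² − ε·(Σ_e |x_e|)²`. -/
theorem variance_lower_bound_almost_independent
    {Ω S : Type*} [Fintype S] [MeasurableSpace Ω]
    (P : Measure Ω) [IsProbabilityMeasure P]
    (q ε : ℝ) (hq0 : 0 ≤ q) (hq1 : q ≤ 1) (hε : 0 ≤ ε)
    (p : S → Ω → ℝ) (hmeas : ∀ e, Measurable (p e))
    (h01 : ∀ e ω, p e ω = 0 ∨ p e ω = 1)
    (hmean : ∀ e, ∫ ω, p e ω ∂P = q)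
    (hcorr : ∀ e e', e ≠ e' → |(∫ ω, p e ω * p e' ω ∂P) - q ^ 2| ≤ ε)
    (x : S → ℝ) :
    q * (1 - q) * (∑ e, (x e) ^ 2) - ε * (∑ e, |x e|) ^ 2 ≤
      variance (fun ω => ∑ e, p e ω * x e) P := by
  classical
  have hLp (e : S) : MemLp (p e) 2 P :=
    MemLp.of_bound (hmeas e).aestronglyMeasurable 1 <| .of_forall fun ω ↦ by
      rcases h01 e ω with h | h <;> simp [h]
  have hcov (i j : S) : cov[p i, p j; P] = (∫ ω, p i ω * p j ω ∂P) - q ^ 2 := by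
    rw [covariance_eq_sub (hLp i) (hLp j), hmean, hmean, sq]
    rfl
  have hself (i : S) : ∫ ω, p i ω * p i ω ∂P = q := by
    rw [← hmean i]
    congr 1 with ω
    rcases h01 i ω with h | h <;> simp [h]
  rw [variance_fun_sum fun e ↦ (hLp e).mul_const (x e)]
  calc
    q * (1 - q) * (∑ e, (x e) ^ 2) - ε * (∑ e, |x e|) ^ 2
      = ∑ i, ∑ j, ((if i = j then q * (1 - q) * x i ^ 2 else 0) - ε * (|x i| * |x j|)) := by
        simp only [Finset.sum_sub_distrib, Finset.sum_ite_eq, Finset.mem_univ, if_true,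
          ← Finset.mul_sum, sq (∑ e, |x e|), Finset.sum_mul_sum]
    _ ≤ ∑ i, ∑ j, cov[fun ω ↦ p i ω * x i, fun ω ↦ p j ω * x j; P] := by
        refine Finset.sum_le_sum fun i _ ↦ Finset.sum_le_sum fun j _ ↦ ?_
        rw [covariance_mul_const_left, covariance_mul_const_right, hcov]
        split_ifs with hij
        · subst hij
          rw [hself]
          nlinarith [mul_nonneg hε (mul_self_nonneg |x i|)]
        · have h := mul_le_mul_of_nonneg_right (hcorr i j hij) (abs_nonneg (x i * x j))
          rw [← abs_mul, abs_mul (x i)] at h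
          linarith [(abs_le.1 h).1]
end

section
/- Let c < 0 and let D = {(a,b) ∈ ℝ² : 0 ≤ a and a² ≤ b}. Define f(a,b) = b + c·√(b/2 + a²). Then the minimum of f over D equals −3c²/8, and it is attained exactly at the point (a,b) = (√(3/8)·|c|, 3c²/8). -/
/-- Completing the square in the radial objective. -/
theorem radial_objective_eq (c : ℝ) {a b : ℝ} (h : a ^ 2 ≤ b) :
    b + c * Real.sqrt (b / 2 + a ^ 2) =
      -(3 * c ^ 2 / 8) + 2 / 3 * (Real.sqrt (b / 2 + a ^ 2) + 3 * c / 4) ^ 2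
        + 2 / 3 * (b - a ^ 2) := by
  have hs : Real.sqrt (b / 2 + a ^ 2) ^ 2 = b / 2 + a ^ 2 :=
    Real.sq_sqrt (by nlinarith [sq_nonneg a])
  linear_combination (-2 / 3) * hs


/-- For `c < 0`, on `D = {(a,b) : 0 ≤ a, a² ≤ b}` the function
`f(a,b) = b + c·√(b/2 + a²)` has minimum `−3c²/8`, attained exactly at
`(a,b) = (√(3/8)·|c|, 3c²/8)`. -/
theorem radial_reduction_minimum (c : ℝ) (hc : c < 0) :
    (∀ a b : ℝ, 0 ≤ a → a ^ 2 ≤ b →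
        -(3 * c ^ 2 / 8) ≤ b + c * Real.sqrt (b / 2 + a ^ 2)) ∧
      (∀ a b : ℝ, 0 ≤ a → a ^ 2 ≤ b →
        (b + c * Real.sqrt (b / 2 + a ^ 2) = -(3 * c ^ 2 / 8) ↔
          a = Real.sqrt (3 / 8) * |c| ∧ b = 3 * c ^ 2 / 8)) := by
  refine ⟨fun a b _ hab => ?_, fun a b ha hab => ⟨fun h => ?_, ?_⟩⟩
  · rw [radial_objective_eq c hab]
    nlinarith [sq_nonneg (Real.sqrt (b / 2 + a ^ 2) + 3 * c / 4)]
  · rw [radial_objective_eq c hab] at h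
    have hsq : (Real.sqrt (b / 2 + a ^ 2) + 3 * c / 4) ^ 2 = 0 :=
      le_antisymm (by linarith) (sq_nonneg _)
    have hb : b = a ^ 2 := by linarith
    have hroot : Real.sqrt (b / 2 + a ^ 2) = -(3 * c / 4) := by
      linarith [pow_eq_zero_iff two_ne_zero |>.mp hsq]
    have hs : Real.sqrt (b / 2 + a ^ 2) ^ 2 = b / 2 + a ^ 2 :=
      Real.sq_sqrt (by nlinarith [sq_nonneg a])
    rw [hroot] at hs
    refine ⟨?_, by linarith⟩
    rw [← Real.sqrt_sq_eq_abs, ← Real.sqrt_mul (by norm_num), eq_comm,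
      Real.sqrt_eq_iff_eq_sq (by positivity) ha]
    linarith
  · rintro ⟨rfl, rfl⟩
    have ha2 : (Real.sqrt (3 / 8) * |c|) ^ 2 = 3 * c ^ 2 / 8 := by
      rw [mul_pow, Real.sq_sqrt (by norm_num), sq_abs]
      ring
    have hroot : Real.sqrt (3 * c ^ 2 / 8 / 2 + 3 * c ^ 2 / 8) = -(3 * c / 4) := by
      rw [Real.sqrt_eq_iff_eq_sq (by positivity) (by linarith)]
      ring
    rw [ha2, hroot]
    ring
end

section
/- Let c < 0 and let μ be a probability measure on ℝ² with finite fourth moment that is invariant under every rotation of ℝ² about the origin. Define J_c(μ) = ∫∫ ‖x−y‖⁴ dμ(x)dμ(y) − (∫∫ ‖x−y‖² dμ(x)dμ(y))² + c·(∫∫ ‖x−y‖⁴ dμ(x)dμ(y))^{1/2}. Then J_c(μ) ≥ −3c²/4, with equality if and only if μ gives full measure to the circle {x ∈ ℝ² : ‖x‖ = (3c²/8)^{1/4}} (in which case, by rotation invariance, μ is the normalized arclength measure on that circle). -/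
open MeasureTheory Real

/-- The point `(a, b)` of the Euclidean plane `ℝ²`. -/
noncomputable def planePt (a b : ℝ) : EuclideanSpace ℝ (Fin 2) :=
  (WithLp.equiv 2 (Fin 2 → ℝ)).symm ![a, b]

/-- Rotation of the Euclidean plane `ℝ²` about the origin by angle `θ`. -/
noncomputable def planeRot (θ : ℝ) (x : EuclideanSpace ℝ (Fin 2)) :
    EuclideanSpace ℝ (Fin 2) :=
  planePt (cos θ * x 0 - sin θ * x 1) (sin θ * x 0 + cos θ * x 1)

/-- The rescaled mean-field t-SNE functional
`J_c(μ) = ∫∫‖x−y‖⁴ dμdμ − (∫∫‖x−y‖² dμdμ)² + c·(∫∫‖x−y‖⁴ dμdμ)^{1/2}`. -/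
noncomputable def tsneJ (c : ℝ) (μ : Measure (EuclideanSpace ℝ (Fin 2))) : ℝ :=
  (∫ x, ∫ y, ‖x - y‖ ^ 4 ∂μ ∂μ) - (∫ x, ∫ y, ‖x - y‖ ^ 2 ∂μ ∂μ) ^ 2 +
    c * Real.sqrt (∫ x, ∫ y, ‖x - y‖ ^ 4 ∂μ ∂μ)

lemma norm_sq_eq_coord_sq_add_coord_sq (x : EuclideanSpace ℝ (Fin 2)) :
    ‖x‖ ^ 2 = x 0 ^ 2 + x 1 ^ 2 := by
  simp [EuclideanSpace.real_norm_sq_eq, Fin.sum_univ_two]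

lemma norm_sub_sq_eq_coord (x y : EuclideanSpace ℝ (Fin 2)) :
    ‖x - y‖ ^ 2 = ‖x‖ ^ 2 + ‖y‖ ^ 2 - 2 * (x 0 * y 0 + x 1 * y 1) := by
  simp only [norm_sq_eq_coord_sq_add_coord_sq, PiLp.sub_apply]
  ring

lemma abs_coord_le_norm (x : EuclideanSpace ℝ (Fin 2)) (i : Fin 2) : |x i| ≤ ‖x‖ := by
  simpa using PiLp.norm_apply_le x i

lemma continuous_planeRot (θ : ℝ) : Continuous (planeRot θ) := by
  unfold planeRot planePt
  refine (PiLp.continuous_toLp 2 _).comp (continuous_pi fun i => ?_)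
  fin_cases i <;> simp <;> fun_prop

lemma norm_planeRot (θ : ℝ) (x : EuclideanSpace ℝ (Fin 2)) : ‖planeRot θ x‖ = ‖x‖ := by
  refine (sq_eq_sq₀ (norm_nonneg _) (norm_nonneg _)).1 ?_
  simp only [norm_sq_eq_coord_sq_add_coord_sq]
  simp [planeRot, planePt]
  linear_combination (x 0 ^ 2 + x 1 ^ 2) * sin_sq_add_cos_sq θ

lemma integral_comp_planeRot {μ : Measure (EuclideanSpace ℝ (Fin 2))} {θ : ℝ}
    (hrot : Measure.map (planeRot θ) μ = μ) {f : EuclideanSpace ℝ (Fin 2) → ℝ}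
    (hf : Continuous f) : ∫ x, f (planeRot θ x) ∂μ = ∫ x, f x ∂μ := by
  conv_rhs => rw [← hrot]
  exact (integral_map (continuous_planeRot θ).aemeasurable hf.aestronglyMeasurable).symm

lemma integrable_of_abs_le_norm_pow {μ : Measure (EuclideanSpace ℝ (Fin 2))}
    [IsProbabilityMeasure μ]
    (h4 : Integrable (fun x : EuclideanSpace ℝ (Fin 2) => ‖x‖ ^ 4) μ) {n : ℕ} (hn : n ≤ 4)
    {f : EuclideanSpace ℝ (Fin 2) → ℝ} (hf : Continuous f) (hb : ∀ x, |f x| ≤ ‖x‖ ^ n) :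
    Integrable f μ := by
  refine ((integrable_const (1 : ℝ)).add h4).mono' hf.aestronglyMeasurable
    (.of_forall fun x => (hb x).trans ?_)
  simp only [Pi.add_apply]
  rcases le_total ‖x‖ 1 with h | h
  · exact (pow_le_one₀ (norm_nonneg x) h).trans (by linarith [pow_nonneg (norm_nonneg x) 4])
  · exact (pow_le_pow_right₀ h hn).trans (by linarith)

section Moments

variable {μ : Measure (EuclideanSpace ℝ (Fin 2))}

lemma integral_eq_zero_of_comp_planeRot_pi (hrot : ∀ θ : ℝ, Measure.map (planeRot θ) μ = μ)
    {f : EuclideanSpace ℝ (Fin 2) → ℝ} (hf : Continuous f)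
    (hodd : ∀ x, f (planeRot π x) = -f x) : ∫ x, f x ∂μ = 0 := by
  have h := integral_comp_planeRot (hrot π) hf
  simp only [hodd, integral_neg] at h
  linarith

lemma integral_coord_eq_zero (hrot : ∀ θ : ℝ, Measure.map (planeRot θ) μ = μ) (i : Fin 2) :
    ∫ x, x i ∂μ = 0 := by
  refine integral_eq_zero_of_comp_planeRot_pi hrot (by fun_prop) fun x => ?_
  fin_cases i <;> simp [planeRot, planePt]

lemma integral_norm_sq_mul_coord_eq_zero (hrot : ∀ θ : ℝ, Measure.map (planeRot θ) μ = μ)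
    (i : Fin 2) : ∫ x, ‖x‖ ^ 2 * x i ∂μ = 0 := by
  refine integral_eq_zero_of_comp_planeRot_pi hrot (by fun_prop) fun x => ?_
  rw [norm_planeRot]
  fin_cases i <;> simp [planeRot, planePt]

lemma integral_coord_mul_coord_eq_zero (hrot : ∀ θ : ℝ, Measure.map (planeRot θ) μ = μ) :
    ∫ x, x 0 * x 1 ∂μ = 0 := by
  have h := integral_comp_planeRot (hrot (π / 2)) (f := fun x => x 0 * x 1) (by fun_prop)
  have e : ∀ x : EuclideanSpace ℝ (Fin 2),
      planeRot (π / 2) x 0 * planeRot (π / 2) x 1 = -(x 0 * x 1) := fun x => by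
    simp [planeRot, planePt, mul_comm]
  simp only [e, integral_neg] at h
  linarith

variable [IsProbabilityMeasure μ]

lemma integrable_norm_sq (h4 : Integrable (fun x : EuclideanSpace ℝ (Fin 2) => ‖x‖ ^ 4) μ) :
    Integrable (fun x : EuclideanSpace ℝ (Fin 2) => ‖x‖ ^ 2) μ :=
  integrable_of_abs_le_norm_pow h4 (n := 2) (by norm_num) (by fun_prop) fun x => by simp

lemma integrable_coord (h4 : Integrable (fun x : EuclideanSpace ℝ (Fin 2) => ‖x‖ ^ 4) μ)
    (i : Fin 2) : Integrable (fun x : EuclideanSpace ℝ (Fin 2) => x i) μ :=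
  integrable_of_abs_le_norm_pow h4 (n := 1) (by norm_num) (by fun_prop) fun x => by
    simpa using abs_coord_le_norm x i

lemma integrable_norm_sq_mul_coord
    (h4 : Integrable (fun x : EuclideanSpace ℝ (Fin 2) => ‖x‖ ^ 4) μ) (i : Fin 2) :
    Integrable (fun x : EuclideanSpace ℝ (Fin 2) => ‖x‖ ^ 2 * x i) μ :=
  integrable_of_abs_le_norm_pow h4 (n := 3) (by norm_num) (by fun_prop) fun x => by
    rw [abs_mul, abs_of_nonneg (sq_nonneg ‖x‖), pow_succ ‖x‖ 2]
    gcongr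
    exact abs_coord_le_norm x i

lemma integrable_coord_mul_coord
    (h4 : Integrable (fun x : EuclideanSpace ℝ (Fin 2) => ‖x‖ ^ 4) μ) (i j : Fin 2) :
    Integrable (fun x : EuclideanSpace ℝ (Fin 2) => x i * x j) μ :=
  integrable_of_abs_le_norm_pow h4 (n := 2) (by norm_num) (by fun_prop) fun x => by
    rw [abs_mul, sq]
    gcongr <;> exact abs_coord_le_norm x _

lemma integral_coord_mul_self (h4 : Integrable (fun x : EuclideanSpace ℝ (Fin 2) => ‖x‖ ^ 4) μ)
    (hrot : ∀ θ : ℝ, Measure.map (planeRot θ) μ = μ) (i : Fin 2) :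
    ∫ x, x i * x i ∂μ = (∫ x, ‖x‖ ^ 2 ∂μ) / 2 := by
  have h := integral_comp_planeRot (hrot (π / 2)) (f := fun x => x 0 * x 0) (by fun_prop)
  have e : ∀ x : EuclideanSpace ℝ (Fin 2),
      planeRot (π / 2) x 0 * planeRot (π / 2) x 0 = x 1 * x 1 := fun x => by
    simp [planeRot, planePt]
  simp only [e] at h
  have hs : ∫ x, ‖x‖ ^ 2 ∂μ = (∫ x, x 0 * x 0 ∂μ) + ∫ x, x 1 * x 1 ∂μ := by
    rw [← integral_add (integrable_coord_mul_coord h4 0 0) (integrable_coord_mul_coord h4 1 1)]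
    simp only [norm_sq_eq_coord_sq_add_coord_sq]
    simp only [sq]
  fin_cases i <;> simp only [Fin.zero_eta, Fin.mk_one] <;> linarith

lemma integral_integral_norm_sub_sq
    (h4 : Integrable (fun x : EuclideanSpace ℝ (Fin 2) => ‖x‖ ^ 4) μ)
    (hrot : ∀ θ : ℝ, Measure.map (planeRot θ) μ = μ) :
    ∫ x, ∫ y, ‖x - y‖ ^ 2 ∂μ ∂μ = 2 * ∫ x, ‖x‖ ^ 2 ∂μ := by
  have h2 := integrable_norm_sq h4
  have i0 := integrable_coord h4 0
  have i1 := integrable_coord h4 1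
  have inner_eq : ∀ x : EuclideanSpace ℝ (Fin 2),
      ∫ y, ‖x - y‖ ^ 2 ∂μ = ‖x‖ ^ 2 + ∫ y, ‖y‖ ^ 2 ∂μ := fun x => by
    have e : ∀ y : EuclideanSpace ℝ (Fin 2), ‖x - y‖ ^ 2 =
        ‖x‖ ^ 2 + ‖y‖ ^ 2 + (-2 * x 0) * y 0 + (-2 * x 1) * y 1 := fun y => by
      rw [norm_sub_sq_eq_coord]; ring
    simp only [e]
    rw [integral_add (by fun_prop) (by fun_prop), integral_add (by fun_prop) (by fun_prop),
      integral_add (by fun_prop) (by fun_prop)]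
    simp only [integral_const_mul, integral_coord_eq_zero hrot, integral_const, probReal_univ,
      one_smul, mul_zero, add_zero]
  simp only [inner_eq]
  rw [integral_add (by fun_prop) (by fun_prop)]
  simp
  ring

lemma integral_integral_norm_sub_pow_four
    (h4 : Integrable (fun x : EuclideanSpace ℝ (Fin 2) => ‖x‖ ^ 4) μ)
    (hrot : ∀ θ : ℝ, Measure.map (planeRot θ) μ = μ) :
    ∫ x, ∫ y, ‖x - y‖ ^ 4 ∂μ ∂μ = 2 * (∫ x, ‖x‖ ^ 4 ∂μ) + 4 * (∫ x, ‖x‖ ^ 2 ∂μ) ^ 2 := by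
  have h2 := integrable_norm_sq h4
  have i0 := integrable_coord h4 0
  have i1 := integrable_coord h4 1
  have n0 := integrable_norm_sq_mul_coord h4 0
  have n1 := integrable_norm_sq_mul_coord h4 1
  have m00 := integrable_coord_mul_coord h4 0 0
  have m01 := integrable_coord_mul_coord h4 0 1
  have m11 := integrable_coord_mul_coord h4 1 1
  have inner_eq : ∀ x : EuclideanSpace ℝ (Fin 2), ∫ y, ‖x - y‖ ^ 4 ∂μ =
      ‖x‖ ^ 4 + (4 * ∫ y, ‖y‖ ^ 2 ∂μ) * ‖x‖ ^ 2 + ∫ y, ‖y‖ ^ 4 ∂μ := fun x => by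
    have e : ∀ y : EuclideanSpace ℝ (Fin 2), ‖x - y‖ ^ 4 =
        ‖x‖ ^ 4 + (2 * ‖x‖ ^ 2) * ‖y‖ ^ 2 + ‖y‖ ^ 4
        + (-4 * ‖x‖ ^ 2 * x 0) * y 0 + (-4 * ‖x‖ ^ 2 * x 1) * y 1
        + (-4 * x 0) * (‖y‖ ^ 2 * y 0) + (-4 * x 1) * (‖y‖ ^ 2 * y 1)
        + (4 * x 0 ^ 2) * (y 0 * y 0) + (8 * x 0 * x 1) * (y 0 * y 1)
        + (4 * x 1 ^ 2) * (y 1 * y 1) := fun y => by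
      rw [show ‖x - y‖ ^ 4 = (‖x - y‖ ^ 2) ^ 2 by ring, norm_sub_sq_eq_coord]; ring
    simp only [e]
    iterate 9 rw [integral_add (by fun_prop) (by fun_prop)]
    simp only [integral_const_mul, integral_coord_eq_zero hrot,
      integral_norm_sq_mul_coord_eq_zero hrot, integral_coord_mul_coord_eq_zero hrot,
      integral_coord_mul_self h4 hrot, integral_const, probReal_univ, one_smul]
    linear_combination (-2 * ∫ y, ‖y‖ ^ 2 ∂μ) * norm_sq_eq_coord_sq_add_coord_sq x
  simp only [inner_eq]
  iterate 2 rw [integral_add (by fun_prop) (by fun_prop)]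
  simp only [integral_const_mul, integral_const, probReal_univ, one_smul]
  ring

/-- The second moment of `‖x‖²` about `A`. -/
lemma integral_norm_sq_sub_mean_sq
    (h4 : Integrable (fun x : EuclideanSpace ℝ (Fin 2) => ‖x‖ ^ 4) μ) (A : ℝ) :
    Integrable (fun x : EuclideanSpace ℝ (Fin 2) => (‖x‖ ^ 2 - A) ^ 2) μ ∧
    ∫ x, (‖x‖ ^ 2 - A) ^ 2 ∂μ =
      (∫ x, ‖x‖ ^ 4 ∂μ) - 2 * A * (∫ x, ‖x‖ ^ 2 ∂μ) + A ^ 2 := by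
  have h2 := integrable_norm_sq h4
  have e : ∀ x : EuclideanSpace ℝ (Fin 2),
      (‖x‖ ^ 2 - A) ^ 2 = ‖x‖ ^ 4 + (-2 * A) * ‖x‖ ^ 2 + A ^ 2 := fun x => by ring
  simp only [e]
  refine ⟨by fun_prop, ?_⟩
  iterate 2 rw [integral_add (by fun_prop) (by fun_prop)]
  simp only [integral_const_mul, integral_const, probReal_univ, one_smul]
  ring

end Moments

lemma two_mul_add_mul_sqrt_ge {A B c : ℝ} (hc : c < 0) (hAB : A ^ 2 ≤ B) :
    -(3 * c ^ 2 / 4) ≤ 2 * B + c * √(2 * B + 4 * A ^ 2) ∧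
      (2 * B + c * √(2 * B + 4 * A ^ 2) = -(3 * c ^ 2 / 4) ↔ B = A ^ 2 ∧ B = 3 * c ^ 2 / 8) := by
  have hB : 0 ≤ B := (sq_nonneg A).trans hAB
  set s := √(2 * B + 4 * A ^ 2) with hs
  have hs2 : s ^ 2 = 2 * B + 4 * A ^ 2 := Real.sq_sqrt (by positivity)
  have key : 2 * B + c * s + 3 * c ^ 2 / 4 = (s + 3 * c / 2) ^ 2 / 3 + 4 / 3 * (B - A ^ 2) := by
    linear_combination (-1 / 3) * hs2
  refine ⟨by nlinarith [sq_nonneg (s + 3 * c / 2)], fun h => ?_, fun ⟨h1, h2⟩ => ?_⟩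
  · have hBA : B = A ^ 2 := by nlinarith [sq_nonneg (s + 3 * c / 2)]
    have hsc : s + 3 * c / 2 = 0 := pow_eq_zero_iff two_ne_zero |>.1 (by nlinarith)
    exact ⟨hBA, by nlinarith⟩
  · have hsc : s = -(3 * c / 2) := by
      refine (sq_eq_sq₀ (Real.sqrt_nonneg _) (by linarith)).1 ?_
      linarith
    rw [hsc] at key ⊢
    linear_combination 2 * h2

lemma norm_eq_rpow_quarter_iff {r : ℝ} (hr : 0 ≤ r) {t : ℝ} (ht : 0 ≤ t) :
    t = r ^ ((1 : ℝ) / 4) ↔ t ^ 4 = r := by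
  have h : (r ^ ((1 : ℝ) / 4)) ^ 4 = r := by
    rw [← Real.rpow_natCast, ← Real.rpow_mul hr]
    norm_num
  constructor
  · rintro rfl
    exact h
  · intro ht4
    exact (pow_left_inj₀ ht (by positivity) four_ne_zero).1 (ht4.trans h.symm)

/-- For `c < 0` and a rotation-invariant probability measure `μ` on
`ℝ²` with finite fourth moment, `J_c(μ) ≥ −3c²/4`, with equality iff `μ` gives full
measure to the circle of radius `(3c²/8)^{1/4}` about the origin. -/
theorem tsneJ_radial_minimizer_ring (c : ℝ) (hc : c < 0)
    (μ : Measure (EuclideanSpace ℝ (Fin 2))) [IsProbabilityMeasure μ]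
    (h4 : Integrable (fun x : EuclideanSpace ℝ (Fin 2) => ‖x‖ ^ 4) μ)
    (hrot : ∀ θ : ℝ, Measure.map (planeRot θ) μ = μ) :
    -(3 * c ^ 2 / 4) ≤ tsneJ c μ ∧
      (tsneJ c μ = -(3 * c ^ 2 / 4) ↔
        μ {x : EuclideanSpace ℝ (Fin 2) | ‖x‖ = (3 * c ^ 2 / 8) ^ ((1 : ℝ) / 4)} = 1) := by
  have hJ : tsneJ c μ = 2 * (∫ x, ‖x‖ ^ 4 ∂μ) +
      c * √(2 * (∫ x, ‖x‖ ^ 4 ∂μ) + 4 * (∫ x, ‖x‖ ^ 2 ∂μ) ^ 2) := by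
    rw [tsneJ, integral_integral_norm_sub_sq h4 hrot, integral_integral_norm_sub_pow_four h4 hrot]
    ring
  have hr : 0 ≤ 3 * c ^ 2 / 8 := by positivity
  set r := 3 * c ^ 2 / 8 with hrdef
  have hS : MeasurableSet {x : EuclideanSpace ℝ (Fin 2) | ‖x‖ = r ^ ((1 : ℝ) / 4)} :=
    (isClosed_eq continuous_norm continuous_const).measurableSet
  have hfull : μ {x : EuclideanSpace ℝ (Fin 2) | ‖x‖ = r ^ ((1 : ℝ) / 4)} = 1 ↔
      ∀ᵐ x ∂μ, ‖x‖ ^ 4 = r := by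
    rw [← mem_ae_iff_prob_eq_one hS]
    exact Filter.eventually_congr
      (.of_forall fun x => norm_eq_rpow_quarter_iff hr (norm_nonneg x))
  obtain ⟨hint, hvar⟩ := integral_norm_sq_sub_mean_sq h4 (∫ x, ‖x‖ ^ 2 ∂μ)
  have hvar0 : 0 ≤ ∫ x, (‖x‖ ^ 2 - ∫ x, ‖x‖ ^ 2 ∂μ) ^ 2 ∂μ :=
    integral_nonneg fun x => sq_nonneg _
  have hmain := two_mul_add_mul_sqrt_ge (A := ∫ x, ‖x‖ ^ 2 ∂μ) (B := ∫ x, ‖x‖ ^ 4 ∂μ) hc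
    (by linarith)
  rw [hJ, hfull]
  refine ⟨hmain.1, hmain.2.trans ⟨fun ⟨h1, h2⟩ => ?_, fun h => ?_⟩⟩
  · have hz : ∫ x, (‖x‖ ^ 2 - ∫ x, ‖x‖ ^ 2 ∂μ) ^ 2 ∂μ = 0 := by linarith
    rw [integral_eq_zero_iff_of_nonneg (fun x => sq_nonneg _) hint] at hz
    filter_upwards [hz] with x hx
    have hx' : ‖x‖ ^ 2 = ∫ x, ‖x‖ ^ 2 ∂μ := sub_eq_zero.1 (pow_eq_zero_iff two_ne_zero |>.1 hx)
    rw [show ‖x‖ ^ 4 = (‖x‖ ^ 2) ^ 2 by ring, hx', ← h1, h2]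
  · have hB : ∫ x, ‖x‖ ^ 4 ∂μ = r := by
      rw [integral_congr_ae h]
      simp
    have hA : ∫ x, ‖x‖ ^ 2 ∂μ = √r := by
      have h' : ∀ᵐ x ∂μ, ‖x‖ ^ 2 = √r := by
        filter_upwards [h] with x hx
        rw [← hx, show ‖x‖ ^ 4 = (‖x‖ ^ 2) ^ 2 by ring, Real.sqrt_sq (sq_nonneg _)]
      rw [integral_congr_ae h']
      simp
    exact ⟨by rw [hB, hA, Real.sq_sqrt hr], hB⟩
end

section
/- Let c > 0 and let μ be a probability measure on ℝ² with finite fourth moment. Define J_c(μ) = ∫∫ ‖x−y‖⁴ dμ(x)dμ(y) − (∫∫ ‖x−y‖² dμ(x)dμ(y))² + c·(∫∫ ‖x−y‖⁴ dμ(x)dμ(y))^{1/2}. Then J_c(μ) ≥ 0, with equality if and only if μ = δ_{x₀} is a Dirac measure at some point x₀ ∈ ℝ². -/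
open MeasureTheory

theorem norm_sub_pow_four_le {E : Type*} [SeminormedAddCommGroup E] (x y : E) :
    ‖x - y‖ ^ 4 ≤ 8 * (‖x‖ ^ 4 + ‖y‖ ^ 4) :=
  calc ‖x - y‖ ^ 4 ≤ (‖x‖ + ‖y‖) ^ 4 := by gcongr; exact norm_sub_le x y
    _ ≤ 8 * (‖x‖ ^ 4 + ‖y‖ ^ 4) := by
      have h := add_pow_le (norm_nonneg x) (norm_nonneg y) 4
      norm_num at h
      exact h

theorem integrable_norm_sub_pow_four_prod {E : Type*} [NormedAddCommGroup E] [MeasurableSpace E]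
    [BorelSpace E] [SecondCountableTopology E] {μ : Measure E} [IsFiniteMeasure μ]
    (h : Integrable (fun x : E => ‖x‖ ^ 4) μ) :
    Integrable (fun p : E × E => ‖p.1 - p.2‖ ^ 4) (μ.prod μ) := by
  refine (((h.comp_fst μ).add (h.comp_snd μ)).const_mul 8).mono'
    (Continuous.aestronglyMeasurable (by fun_prop)) (.of_forall fun p => ?_)
  rw [Real.norm_of_nonneg (by positivity)]
  exact norm_sub_pow_four_le p.1 p.2

theorem sq_integral_le_integral_sq {Ω : Type*} [MeasurableSpace Ω] {ν : Measure Ω}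
    [IsProbabilityMeasure ν] {f : Ω → ℝ} (hf : MemLp f 2 ν) :
    (∫ ω, f ω ∂ν) ^ 2 ≤ ∫ ω, f ω ^ 2 ∂ν := by
  have h := ProbabilityTheory.variance_nonneg f ν
  rw [ProbabilityTheory.variance_eq_sub hf] at h
  simpa using h

theorem eq_dirac_of_ae_eq {α : Type*} [MeasurableSpace α] {μ : Measure α}
    [IsProbabilityMeasure μ] {a : α} (h : ∀ᵐ x ∂μ, a = x) : μ = Measure.dirac a := by
  calc μ = μ.map id := Measure.map_id.symm
    _ = μ.map (fun _ => a) := Measure.map_congr (h.mono fun _ hx => hx.symm)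
    _ = Measure.dirac a := by simp [Measure.map_const]

theorem tsneJ_dirac (c : ℝ) (a : EuclideanSpace ℝ (Fin 2)) : tsneJ c (Measure.dirac a) = 0 := by
  simp [tsneJ]

/-- For `c > 0` and a probability measure `μ` on `ℝ²` with finite
fourth moment, `J_c(μ) ≥ 0`, with equality iff `μ` is a Dirac measure. -/
theorem tsneJ_nonneg_and_eq_zero_iff_dirac (c : ℝ) (hc : 0 < c)
    (μ : Measure (EuclideanSpace ℝ (Fin 2))) [IsProbabilityMeasure μ]
    (h4 : Integrable (fun x : EuclideanSpace ℝ (Fin 2) => ‖x‖ ^ 4) μ) :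
    0 ≤ tsneJ c μ ∧
      (tsneJ c μ = 0 ↔ ∃ x₀ : EuclideanSpace ℝ (Fin 2), μ = Measure.dirac x₀) := by
  have hint := integrable_norm_sub_pow_four_prod h4
  have hsq (p : EuclideanSpace ℝ (Fin 2) × EuclideanSpace ℝ (Fin 2)) :
      (‖p.1 - p.2‖ ^ 2) ^ 2 = ‖p.1 - p.2‖ ^ 4 := by ring
  have hmem : MemLp (fun p : EuclideanSpace ℝ (Fin 2) × EuclideanSpace ℝ (Fin 2) =>
      ‖p.1 - p.2‖ ^ 2) 2 (μ.prod μ) := by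
    rw [memLp_two_iff_integrable_sq (Continuous.aestronglyMeasurable (by fun_prop))]
    simpa only [hsq] using hint
  have hvar := sq_integral_le_integral_sq hmem
  simp only [hsq] at hvar
  have hfourth := integral_prod _ hint
  rw [hfourth, integral_prod _ (hmem.integrable one_le_two)] at hvar
  have hsqrt := mul_nonneg hc.le (Real.sqrt_nonneg (∫ x, ∫ y, ‖x - y‖ ^ 4 ∂μ ∂μ))
  refine ⟨by unfold tsneJ; linarith, fun hJ => ?_, ?_⟩
  · have hzero : c * Real.sqrt (∫ x, ∫ y, ‖x - y‖ ^ 4 ∂μ ∂μ) = 0 := by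
      unfold tsneJ at hJ
      linarith
    have hle := Real.sqrt_eq_zero'.mp ((mul_eq_zero.mp hzero).resolve_left hc.ne')
    rw [← hfourth] at hle
    have hnonneg : 0 ≤ fun p : EuclideanSpace ℝ (Fin 2) × EuclideanSpace ℝ (Fin 2) =>
        ‖p.1 - p.2‖ ^ 4 := fun p => by positivity
    have hae := (integral_eq_zero_iff_of_nonneg hnonneg hint).mp
      (hle.antisymm (integral_nonneg hnonneg))
    obtain ⟨a, ha⟩ := (Measure.ae_ae_of_ae_prod hae).exists
    refine ⟨a, eq_dirac_of_ae_eq (ha.mono fun y hy => ?_)⟩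
    simpa [sub_eq_zero] using hy
  · rintro ⟨a, rfl⟩
    exact tsneJ_dirac c a
end

section
/- Let r > 0 and let μ be a probability measure on ℝ² whose support is contained in a closed ball of radius r. Then |∫∫ log(1+‖x−y‖²) dμ(x)dμ(y) − ∫∫ ‖x−y‖² dμ(x)dμ(y) + (1/2)·∫∫ ‖x−y‖⁴ dμ(x)dμ(y)| ≤ (64/3)·r⁶; that is, the second t-SNE energy term equals its second-order Taylor expansion up to an error of order r⁶. -/
open MeasureTheory

theorem Real.sub_sq_div_two_le_log_one_add {t : ℝ} (ht : 0 ≤ t) :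
    t - t ^ 2 / 2 ≤ Real.log (1 + t) := by
  have hder : ∀ s : ℝ, 0 ≤ s → HasDerivAt (fun s => Real.log (1 + s) - (s - s ^ 2 / 2))
      (s ^ 2 / (1 + s)) s := fun s hs => by
    have hs1 : 1 + s ≠ 0 := by positivity
    refine ((((hasDerivAt_id' s).const_add 1).log hs1).sub
      ((hasDerivAt_id' s).sub ((hasDerivAt_pow 2 s).div_const 2))).congr_deriv ?_
    field_simp
    ring
  have hmono := monotoneOn_of_hasDerivWithinAt_nonneg (convex_Ici (0 : ℝ))
    (fun s hs => (hder s hs).continuousAt.continuousWithinAt)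
    (fun s hs => (hder s (interior_subset hs)).hasDerivWithinAt)
    (fun s hs => by
      have hs0 : (0 : ℝ) ≤ s := interior_subset hs
      positivity)
  have h := hmono Set.self_mem_Ici ht ht
  norm_num at h
  linarith

theorem Real.log_one_add_le_sub_sq_div_two_add_cube_div_three {t : ℝ} (ht : 0 ≤ t) :
    Real.log (1 + t) ≤ t - t ^ 2 / 2 + t ^ 3 / 3 := by
  have hder : ∀ s : ℝ, 0 ≤ s →
      HasDerivAt (fun s => s - s ^ 2 / 2 + s ^ 3 / 3 - Real.log (1 + s))
        (s ^ 3 / (1 + s)) s := fun s hs => by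
    have hs1 : 1 + s ≠ 0 := by positivity
    refine ((((hasDerivAt_id' s).sub ((hasDerivAt_pow 2 s).div_const 2)).add
      ((hasDerivAt_pow 3 s).div_const 3)).sub
      (((hasDerivAt_id' s).const_add 1).log hs1)).congr_deriv ?_
    field_simp
    ring
  have hmono := monotoneOn_of_hasDerivWithinAt_nonneg (convex_Ici (0 : ℝ))
    (fun s hs => (hder s hs).continuousAt.continuousWithinAt)
    (fun s hs => (hder s (interior_subset hs)).hasDerivWithinAt)
    (fun s hs => by
      have hs0 : (0 : ℝ) ≤ s := interior_subset hs
      positivity)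
  have h := hmono Set.self_mem_Ici ht ht
  norm_num at h
  linarith

theorem ae_prod_norm_sub_le_of_closedBall {E : Type*} [NormedAddCommGroup E] [MeasurableSpace E]
    {μ : Measure E} [SFinite μ] {z : E} {r : ℝ} (h : μ (Metric.closedBall z r)ᶜ = 0) :
    ∀ᵐ p ∂μ.prod μ, ‖p.1 - p.2‖ ≤ 2 * r := by
  have hz : ∀ᵐ x ∂μ, x ∈ Metric.closedBall z r := h
  filter_upwards [Measure.quasiMeasurePreserving_fst.ae hz,
    Measure.quasiMeasurePreserving_snd.ae hz] with p h₁ h₂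
  rw [Metric.mem_closedBall] at h₁ h₂
  rw [← dist_eq_norm]
  linarith [dist_triangle_right p.1 p.2 z]

theorem integrable_prod_comp_norm_sub {E : Type*} [NormedAddCommGroup E] [MeasurableSpace E]
    [BorelSpace E] [SecondCountableTopology E] {μ : Measure E} [IsFiniteMeasure μ] {R : ℝ}
    (h : ∀ᵐ p ∂μ.prod μ, ‖p.1 - p.2‖ ≤ R) {φ : ℝ → ℝ} (hφm : Measurable φ)
    (hφ : ContinuousOn φ (Set.Ici 0)) :
    Integrable (fun p : E × E => φ ‖p.1 - p.2‖) (μ.prod μ) := by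
  obtain ⟨C, hC⟩ := (isCompact_Icc (a := (0 : ℝ)) (b := R)).exists_bound_of_continuousOn
    (hφ.mono Set.Icc_subset_Ici_self)
  refine Integrable.of_bound
    (hφm.comp (measurable_fst.sub measurable_snd).norm).aestronglyMeasurable C ?_
  filter_upwards [h] with p hp
  exact hC _ ⟨norm_nonneg _, hp⟩

/-- For a probability measure `μ` on `ℝ²` supported in a closed ball of
radius `r > 0`, the second t-SNE energy term equals its second-order Taylor expansion up
to an error of size `(64/3)·r⁶`:
`|∫∫ log(1+‖x−y‖²) dμdμ − ∫∫‖x−y‖² dμdμ + (1/2)∫∫‖x−y‖⁴ dμdμ| ≤ (64/3)·r⁶`. -/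
theorem tsne_second_term_taylor_expansion (r : ℝ) (hr : 0 < r)
    (μ : Measure (EuclideanSpace ℝ (Fin 2))) [IsProbabilityMeasure μ]
    (hsupp : ∃ z : EuclideanSpace ℝ (Fin 2), μ (Metric.closedBall z r)ᶜ = 0) :
    |(∫ x, ∫ y, Real.log (1 + ‖x - y‖ ^ 2) ∂μ ∂μ) - (∫ x, ∫ y, ‖x - y‖ ^ 2 ∂μ ∂μ) +
        (1 / 2) * ∫ x, ∫ y, ‖x - y‖ ^ 4 ∂μ ∂μ| ≤ (64 / 3) * r ^ 6 := by
  obtain ⟨z, hz⟩ := hsupp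
  have hle := ae_prod_norm_sub_le_of_closedBall hz
  have hlog : Integrable (fun p => Real.log (1 + ‖p.1 - p.2‖ ^ 2)) (μ.prod μ) :=
    integrable_prod_comp_norm_sub (φ := fun t => Real.log (1 + t ^ 2)) hle (by fun_prop)
      (Continuous.log (by fun_prop) fun t => by positivity).continuousOn
  have hsq : Integrable (fun p => ‖p.1 - p.2‖ ^ 2) (μ.prod μ) :=
    integrable_prod_comp_norm_sub (φ := fun t => t ^ 2) hle (by fun_prop) (by fun_prop)
  have hquart : Integrable (fun p => ‖p.1 - p.2‖ ^ 4) (μ.prod μ) :=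
    integrable_prod_comp_norm_sub (φ := fun t => t ^ 4) hle (by fun_prop) (by fun_prop)
  have hdiff : Integrable (fun p => Real.log (1 + ‖p.1 - p.2‖ ^ 2) - ‖p.1 - p.2‖ ^ 2)
      (μ.prod μ) := hlog.sub hsq
  rw [← integral_prod _ hlog, ← integral_prod _ hsq, ← integral_prod _ hquart,
    ← integral_const_mul, ← integral_sub hlog hsq,
    ← integral_add hdiff (hquart.const_mul _), ← Real.norm_eq_abs]
  refine (norm_integral_le_of_norm_le_const (C := 64 / 3 * r ^ 6) ?_).trans_eq (by simp)
  filter_upwards [hle] with p hp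
  have hpow : ‖p.1 - p.2‖ ^ 6 ≤ (2 * r) ^ 6 := by gcongr
  have hlower := Real.sub_sq_div_two_le_log_one_add (sq_nonneg ‖p.1 - p.2‖)
  have hupper := Real.log_one_add_le_sub_sq_div_two_add_cube_div_three (sq_nonneg ‖p.1 - p.2‖)
  rw [Real.norm_eq_abs, abs_le]
  constructor
  · have : 0 < r ^ 6 := by positivity
    nlinarith
  · nlinarith
end
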